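/- arXiv:1903.07242 — 2 statements merged into one kernel-verified Lean document; each statement's English description precedes it below -/
import Mathlib

section
/- Let T be a δ-Jordan Lie supertriple system with H³_δ(T,T) = 0. Then T is analytically rigid: every 1-parameter formal deformation f_t of T is equivalent to the null deformation f₀. -/
/-- The sign `(-1)^{ij}` for degrees `i, j ∈ ℤ/2`, valued in the field `k`. -/
def sgn (k : Type) [Field k] (i j : ZMod 2) : k := (-1 : k) ^ (i.val * j.val)

/-- A `δ`-Jordan Lie supertriple system: a `ℤ/2`-graded vector space `M` over `k`
with a trilinear product satisfying the four graded axioms. -/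
structure DJLSTS (k : Type) [Field k] (M : Type) [AddCommGroup M] [Module k M] (δ : k) where
  grade : ZMod 2 → Submodule k M
  direct : DirectSum.IsInternal grade
  br : M →ₗ[k] M →ₗ[k] M →ₗ[k] M
  delta_pm : δ = 1 ∨ δ = -1
  grade_br : ∀ {i j l : ZMod 2} {a b c : M},
      a ∈ grade i → b ∈ grade j → c ∈ grade l → br a b c ∈ grade (i + j + l)
  skew : ∀ {i j : ZMod 2} {a b : M}, a ∈ grade i → b ∈ grade j → ∀ c : M,
      br b a c = -((δ * sgn k i j) • br a b c)
  cyclic : ∀ {i j l : ZMod 2} {a b c : M},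
      a ∈ grade i → b ∈ grade j → c ∈ grade l →
      sgn k i l • br a b c + sgn k j i • br b c a + sgn k l j • br c a b = 0
  fund : ∀ {i j l m : ZMod 2} {a b c d : M},
      a ∈ grade i → b ∈ grade j → c ∈ grade l → d ∈ grade m → ∀ e : M,
      br a b (br c d e) = br (br a b c) d e + sgn k l (i + j) • br c (br a b d) e
        + (δ * sgn k (i + j) (l + m)) • br c d (br a b e)

/-- A `δ`-Jordan Lie superalgebra. -/
structure DJLSA (k : Type) [Field k] (M : Type) [AddCommGroup M] [Module k M] (δ : k) where
  grade : ZMod 2 → Submodule k M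
  direct : DirectSum.IsInternal grade
  br2 : M →ₗ[k] M →ₗ[k] M
  delta_pm : δ = 1 ∨ δ = -1
  grade_br2 : ∀ {i j : ZMod 2} {a b : M},
      a ∈ grade i → b ∈ grade j → br2 a b ∈ grade (i + j)
  skew2 : ∀ {i j : ZMod 2} {a b : M}, a ∈ grade i → b ∈ grade j →
      br2 b a = -((δ * sgn k i j) • br2 a b)
  jacobi : ∀ {i j l : ZMod 2} {a b c : M},
      a ∈ grade i → b ∈ grade j → c ∈ grade l →
      (δ * sgn k i l) • br2 (br2 a b) c + (δ * sgn k j i) • br2 (br2 b c) a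
        + (δ * sgn k l j) • br2 (br2 c a) b = 0

/-- An (ungraded) `δ`-Jordan Lie triple system. -/
structure DJLTS (k : Type) [Field k] (W : Type) [AddCommGroup W] [Module k W] (δ : k) where
  br : W →ₗ[k] W →ₗ[k] W →ₗ[k] W
  delta_pm : δ = 1 ∨ δ = -1
  skew : ∀ a b c : W, br b a c = -(δ • br a b c)
  cyclic : ∀ a b c : W, br a b c + br b c a + br c a b = 0
  fund : ∀ a b c d e : W,
      br a b (br c d e) = br (br a b c) d e + br c (br a b d) e + δ • br c d (br a b e)

variable {k : Type} [Field k] {M : Type} [AddCommGroup M] [Module k M] {δ : k}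
variable {W : Type} [AddCommGroup W] [Module k W]

/-- `D` is homogeneous of degree `s` with respect to the grading of `S`. -/
def IsHomog (S : DJLSTS k M δ) (s : ZMod 2) (D : M →ₗ[k] M) : Prop :=
  ∀ (i : ZMod 2) (a : M), a ∈ S.grade i → D a ∈ S.grade (s + i)

/-- Supercommutator `[D₁,D₂] = D₁D₂ - (-1)^{|D₁||D₂|} D₂D₁` of homogeneous operators
of degrees `s₁`, `s₂`. -/
def scomm (s₁ s₂ : ZMod 2) (D₁ D₂ : M →ₗ[k] M) : M →ₗ[k] M :=
  D₁ ∘ₗ D₂ - sgn k s₁ s₂ • (D₂ ∘ₗ D₁)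

/-- Homogeneous `n`-derivation of degree `s`. -/
def IsDer (S : DJLSTS k M δ) (n : ℕ) (s : ZMod 2) (D : M →ₗ[k] M) : Prop :=
  IsHomog S s D ∧ ∀ {i j : ZMod 2} {a b : M}, a ∈ S.grade i → b ∈ S.grade j → ∀ c : M,
    δ ^ n • S.br (D a) b c + (δ ^ n * sgn k s i) • S.br a (D b) c
      + (δ ^ n * sgn k s (i + j)) • S.br a b (D c) = D (S.br a b c)

/-- Homogeneous generalized `n`-derivation of degree `s`, with associated maps `D' D'' D'''`. -/
def IsGenDer (S : DJLSTS k M δ) (n : ℕ) (s : ZMod 2) (D D' D'' D''' : M →ₗ[k] M) : Prop :=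
  IsHomog S s D ∧ IsHomog S s D' ∧ IsHomog S s D'' ∧ IsHomog S s D''' ∧
  ∀ {i j : ZMod 2} {a b : M}, a ∈ S.grade i → b ∈ S.grade j → ∀ c : M,
    δ ^ n • S.br (D a) b c + (δ ^ n * sgn k s i) • S.br a (D' b) c
      + (δ ^ n * sgn k s (i + j)) • S.br a b (D'' c) = D''' (S.br a b c)

/-- Membership in the `n`-centroid, for `D` homogeneous of degree `s`. -/
def IsCentroid (S : DJLSTS k M δ) (n : ℕ) (s : ZMod 2) (D : M →ₗ[k] M) : Prop :=
  IsHomog S s D ∧ ∀ {i j : ZMod 2} {a b : M}, a ∈ S.grade i → b ∈ S.grade j → ∀ c : M,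
    δ ^ n • S.br (D a) b c = D (S.br a b c) ∧
    (δ ^ n * sgn k s i) • S.br a (D b) c = D (S.br a b c) ∧
    (δ ^ n * sgn k s (i + j)) • S.br a b (D c) = D (S.br a b c)

/-- Membership in the quasicentroid, for `D` homogeneous of degree `s`. -/
def IsQC (S : DJLSTS k M δ) (s : ZMod 2) (D : M →ₗ[k] M) : Prop :=
  IsHomog S s D ∧ ∀ a b c : M, D (S.br a b c) = S.br (D a) b c

/-- Central derivation. -/
def IsZDer (S : DJLSTS k M δ) (D : M →ₗ[k] M) : Prop :=
  ∀ a b c : M, D (S.br a b c) = 0 ∧ S.br (D a) b c = 0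

/-- The operator `D(a,b) = (-1)^{|a||b|}θ(b,a) - δθ(a,b)` attached to a bilinear map `θ`,
where `i, j` are the degrees of `a, b`. -/
def Dop (δ : k) (θ : M →ₗ[k] M →ₗ[k] W →ₗ[k] W) (i j : ZMod 2) (a b : M) : W →ₗ[k] W :=
  sgn k i j • θ b a - δ • θ a b

/-- A representation of a `δ`-Jordan Lie supertriple system `S` on a
`ℤ/2`-graded vector space `V`. -/
structure DJRep (S : DJLSTS k M δ) (V : Type) [AddCommGroup V] [Module k V] where
  Vgrade : ZMod 2 → Submodule k V
  Vdirect : DirectSum.IsInternal Vgrade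
  θ : M →ₗ[k] M →ₗ[k] V →ₗ[k] V
  θ_grade : ∀ {i j n : ZMod 2} {a b : M} {v : V},
      a ∈ S.grade i → b ∈ S.grade j → v ∈ Vgrade n → θ a b v ∈ Vgrade (i + j + n)
  rep1 : ∀ {i j l m : ZMod 2} {a b c d : M},
      a ∈ S.grade i → b ∈ S.grade j → c ∈ S.grade l → d ∈ S.grade m → ∀ v : V,
      sgn k (i + j) (l + m) • θ c d (θ a b v)
        - (δ * sgn k i j * sgn k m (l + i)) • θ b d (θ a c v)
        - θ a (S.br b c d) v + sgn k i (j + l) • Dop δ θ j l b c (θ a d v) = 0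
  rep2 : ∀ {i j l m : ZMod 2} {a b c d : M},
      a ∈ S.grade i → b ∈ S.grade j → c ∈ S.grade l → d ∈ S.grade m → ∀ v : V,
      (δ * sgn k (i + j) (l + m)) • θ c d (Dop δ θ i j a b v)
        - δ • Dop δ θ i j a b (θ c d v)
        + θ (S.br a b c) d v + (δ * sgn k l (i + j)) • θ c (S.br a b d) v = 0
  rep3 : ∀ {i j l m : ZMod 2} {a b c d : M},
      a ∈ S.grade i → b ∈ S.grade j → c ∈ S.grade l → d ∈ S.grade m → ∀ v : V,
      Dop δ θ (i + j + l) m (S.br a b c) d v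
        + sgn k l (i + j) • Dop δ θ l (i + j + m) c (S.br a b d) v
        - δ • Dop δ θ i j a b (Dop δ θ l m c d v)
        + sgn k (i + j) (l + m) • Dop δ θ l m c d (Dop δ θ i j a b v) = 0

/-- The coboundary `d¹` of a `1`-cochain `f` of degree `s`, as a function of the degrees
`i j l` and the (homogeneous) arguments. -/
def d1 (S : DJLSTS k M δ) (R : DJRep S W) (s : ZMod 2) (f : M →ₗ[k] W) :
    ZMod 2 → ZMod 2 → ZMod 2 → M → M → M → W := fun i j l x₁ x₂ x₃ =>
  sgn k (s + i) (j + l) • R.θ x₂ x₃ (f x₁) - f (S.br x₁ x₂ x₃)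
    + (δ * sgn k s (i + j)) • Dop δ R.θ i j x₁ x₂ (f x₃)
    - (δ * sgn k j l * sgn k s (i + l)) • R.θ x₁ x₃ (f x₂)

/-- The coboundary `d³` of a `3`-cochain `g` of degree `s` (given together with the
degrees of its arguments), as a function of the degrees and the (homogeneous) arguments. -/
def d3 (S : DJLSTS k M δ) (R : DJRep S W) (s : ZMod 2)
    (g : ZMod 2 → ZMod 2 → ZMod 2 → M → M → M → W) :
    ZMod 2 → ZMod 2 → ZMod 2 → ZMod 2 → ZMod 2 → M → M → M → M → M → W :=
  fun i₁ i₂ i₃ i₄ i₅ x₁ x₂ x₃ x₄ x₅ =>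
    sgn k (s + i₁ + i₂ + i₃) (i₄ + i₅) • R.θ x₄ x₅ (g i₁ i₂ i₃ x₁ x₂ x₃)
    - (δ * sgn k (s + i₁ + i₂) (i₃ + i₅) * sgn k i₄ i₅) • R.θ x₃ x₅ (g i₁ i₂ i₄ x₁ x₂ x₄)
    - (δ * sgn k s (i₁ + i₂)) • Dop δ R.θ i₁ i₂ x₁ x₂ (g i₃ i₄ i₅ x₃ x₄ x₅)
    + sgn k (s + i₁ + i₂) (i₃ + i₄) • Dop δ R.θ i₃ i₄ x₃ x₄ (g i₁ i₂ i₅ x₁ x₂ x₅)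
    + g (i₁ + i₂ + i₃) i₄ i₅ (S.br x₁ x₂ x₃) x₄ x₅
    - g i₁ i₂ (i₃ + i₄ + i₅) x₁ x₂ (S.br x₃ x₄ x₅)
    + sgn k i₃ (i₁ + i₂) • g i₃ (i₁ + i₂ + i₄) i₅ x₃ (S.br x₁ x₂ x₄) x₅
    + (δ * sgn k (i₁ + i₂) (i₃ + i₄)) • g i₃ i₄ (i₁ + i₂ + i₅) x₃ x₄ (S.br x₁ x₂ x₅)

/-- An even trilinear map `ψ` is a `3`-cocycle of `S` (with respect to the adjoint
representation): `d³ψ = 0`, written out explicitly. -/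
def IsCocycle3 (S : DJLSTS k M δ) (ψ : M →ₗ[k] M →ₗ[k] M →ₗ[k] M) : Prop :=
  ∀ {i₁ i₂ i₃ i₄ : ZMod 2} {x₁ x₂ x₃ x₄ : M},
    x₁ ∈ S.grade i₁ → x₂ ∈ S.grade i₂ → x₃ ∈ S.grade i₃ → x₄ ∈ S.grade i₄ → ∀ x₅ : M,
    S.br x₁ x₂ (ψ x₃ x₄ x₅) + ψ x₁ x₂ (S.br x₃ x₄ x₅)
      = S.br (ψ x₁ x₂ x₃) x₄ x₅ + ψ (S.br x₁ x₂ x₃) x₄ x₅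
        + sgn k i₃ (i₁ + i₂) • (S.br x₃ (ψ x₁ x₂ x₄) x₅ + ψ x₃ (S.br x₁ x₂ x₄) x₅)
        + (δ * sgn k (i₁ + i₂) (i₃ + i₄))
            • (S.br x₃ x₄ (ψ x₁ x₂ x₅) + ψ x₃ x₄ (S.br x₁ x₂ x₅))

/-- A 1-parameter formal deformation `f_t = ∑ fᵢ tⁱ` of `S`, recorded by its sequence of
coefficients, satisfying equations (4.5)–(4.8). -/
def IsDeformation (S : DJLSTS k M δ) (F : ℕ → (M →ₗ[k] M →ₗ[k] M →ₗ[k] M)) : Prop :=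
  F 0 = S.br ∧
  (∀ (p : ℕ) {i j l : ZMod 2} {a b c : M},
      a ∈ S.grade i → b ∈ S.grade j → c ∈ S.grade l → F p a b c ∈ S.grade (i + j + l)) ∧
  (∀ (p : ℕ) {i j : ZMod 2} {a b : M}, a ∈ S.grade i → b ∈ S.grade j → ∀ c : M,
      F p b a c = -((δ * sgn k i j) • F p a b c)) ∧
  (∀ (p : ℕ) {i j l : ZMod 2} {a b c : M},
      a ∈ S.grade i → b ∈ S.grade j → c ∈ S.grade l →
      sgn k i l • F p a b c + sgn k j i • F p b c a + sgn k l j • F p c a b = 0) ∧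
  (∀ (n : ℕ) {i j l m : ZMod 2} {a b c d : M},
      a ∈ S.grade i → b ∈ S.grade j → c ∈ S.grade l → d ∈ S.grade m → ∀ e : M,
      ∑ p ∈ Finset.range (n + 1), F p a b (F (n - p) c d e)
        = ∑ p ∈ Finset.range (n + 1),
            (F p (F (n - p) a b c) d e
              + sgn k l (i + j) • F p c (F (n - p) a b d) e
              + (δ * sgn k (i + j) (l + m)) • F p c d (F (n - p) a b e)))

/-- Equivalence of two formal deformations via a formal isomorphism
`φ_t = ∑ φᵢ tⁱ` with `φ₀ = id`: `φ_t ∘ f_t = f'_t ∘ (φ_t × φ_t × φ_t)` coefficientwise. -/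
def DefEquiv (S : DJLSTS k M δ) (F F' : ℕ → (M →ₗ[k] M →ₗ[k] M →ₗ[k] M))
    (φ : ℕ → (M →ₗ[k] M)) : Prop :=
  φ 0 = LinearMap.id ∧
  ∀ (n : ℕ) (x₁ x₂ x₃ : M),
    ∑ p ∈ Finset.range (n + 1), φ p (F (n - p) x₁ x₂ x₃)
      = ∑ q ∈ Finset.Nat.antidiagonalTuple 4 n,
          F' (q 0) (φ (q 1) x₁) (φ (q 2) x₂) (φ (q 3) x₃)

/-- Nijenhuis operator on a `δ`-Jordan Lie supertriple system. -/
def IsNijenhuis (S : DJLSTS k M δ) (N : M →ₗ[k] M) : Prop :=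
  (∀ x₁ x₂ x₃ : M, S.br (N x₁) (N x₂) (N x₃) = 0) ∧
  (∀ x₁ x₂ x₃ : M,
    N (N (S.br x₁ x₂ x₃))
      = N (S.br (N x₁) x₂ x₃) + N (S.br x₁ (N x₂) x₃) + N (S.br x₁ x₂ (N x₃))
        - S.br (N x₁) (N x₂) x₃ - S.br x₁ (N x₂) (N x₃) - S.br (N x₁) x₂ (N x₃))

section Rigidity
open Finset

/-- Triples of natural numbers with sum `n`. -/
def trip (n : ℕ) : Finset (ℕ × ℕ × ℕ) :=
  ((range (n + 1)) ×ˢ (range (n + 1)) ×ˢ (range (n + 1))).filter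
    (fun p => p.1 + p.2.1 + p.2.2 = n)

theorem mem_trip (n : ℕ) (p : ℕ × ℕ × ℕ) : p ∈ trip n ↔ p.1 + p.2.1 + p.2.2 = n := by
  simp only [trip, mem_filter, mem_product, mem_range]
  omega

theorem reA (G : ℕ → ℕ → ℕ → M) (n : ℕ) :
    ∑ u ∈ Finset.HasAntidiagonal.antidiagonal n, ∑ v ∈ Finset.HasAntidiagonal.antidiagonal u.2, G u.1 v.1 v.2
      = ∑ u ∈ Finset.HasAntidiagonal.antidiagonal n, ∑ v ∈ Finset.HasAntidiagonal.antidiagonal u.2, G v.1 v.2 u.1 := by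
  rw [sum_sigma', sum_sigma']
  refine sum_nbij' (fun x => ⟨(x.2.2, x.1.1 + x.2.1), (x.1.1, x.2.1)⟩)
    (fun x => ⟨(x.2.1, x.2.2 + x.1.1), (x.2.2, x.1.1)⟩) ?_ ?_ ?_ ?_ ?_ <;>
  · rintro ⟨⟨a, b⟩, ⟨c, d⟩⟩
    simp only [mem_sigma, Finset.HasAntidiagonal.mem_antidiagonal]
    rintro ⟨rfl, rfl⟩
    first | rfl | (constructor <;> first | trivial | omega)

theorem reB3 (G : ℕ → ℕ → ℕ → ℕ → M) (n : ℕ) :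
    ∑ u ∈ Finset.HasAntidiagonal.antidiagonal n, ∑ v ∈ trip u.2, G v.1 v.2.1 v.2.2 u.1
      = ∑ u ∈ trip n, ∑ v ∈ Finset.HasAntidiagonal.antidiagonal u.2.2, G u.1 u.2.1 v.1 v.2 := by
  rw [sum_sigma', sum_sigma']
  refine sum_nbij' (fun x => ⟨(x.2.1, x.2.2.1, x.2.2.2 + x.1.1), (x.2.2.2, x.1.1)⟩)
    (fun x => ⟨(x.2.2, x.1.1 + x.1.2.1 + x.2.1), (x.1.1, x.1.2.1, x.2.1)⟩) ?_ ?_ ?_ ?_ ?_ <;>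
  · rintro ⟨_, _⟩
    simp only [mem_sigma, Finset.HasAntidiagonal.mem_antidiagonal, mem_trip]
    rintro ⟨h1, h2⟩
    grind

theorem reB2 (G : ℕ → ℕ → ℕ → ℕ → M) (n : ℕ) :
    ∑ u ∈ Finset.HasAntidiagonal.antidiagonal n, ∑ v ∈ trip u.2, G v.1 v.2.1 v.2.2 u.1
      = ∑ u ∈ trip n, ∑ v ∈ Finset.HasAntidiagonal.antidiagonal u.2.1, G u.1 v.1 u.2.2 v.2 := by
  rw [sum_sigma', sum_sigma']
  refine sum_nbij' (fun x => ⟨(x.2.1, x.2.2.1 + x.1.1, x.2.2.2), (x.2.2.1, x.1.1)⟩)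
    (fun x => ⟨(x.2.2, x.1.1 + x.2.1 + x.1.2.2), (x.1.1, x.2.1, x.1.2.2)⟩) ?_ ?_ ?_ ?_ ?_ <;>
  · rintro ⟨_, _⟩
    simp only [mem_sigma, Finset.HasAntidiagonal.mem_antidiagonal, mem_trip]
    rintro ⟨h1, h2⟩
    grind

theorem reB1 (G : ℕ → ℕ → ℕ → ℕ → M) (n : ℕ) :
    ∑ u ∈ Finset.HasAntidiagonal.antidiagonal n, ∑ v ∈ trip u.2, G v.1 v.2.1 v.2.2 u.1
      = ∑ u ∈ trip n, ∑ v ∈ Finset.HasAntidiagonal.antidiagonal u.1, G v.1 u.2.1 u.2.2 v.2 := by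
  rw [sum_sigma', sum_sigma']
  refine sum_nbij' (fun x => ⟨(x.2.1 + x.1.1, x.2.2.1, x.2.2.2), (x.2.1, x.1.1)⟩)
    (fun x => ⟨(x.2.2, x.2.1 + x.1.2.1 + x.1.2.2), (x.2.1, x.1.2.1, x.1.2.2)⟩) ?_ ?_ ?_ ?_ ?_ <;>
  · rintro ⟨_, _⟩
    simp only [mem_sigma, Finset.HasAntidiagonal.mem_antidiagonal, mem_trip]
    rintro ⟨h1, h2⟩
    grind

/- Arguments of `H`: indices of `a b c d e`. -/
theorem reC1 (H : ℕ → ℕ → ℕ → ℕ → ℕ → M) (n : ℕ) :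
    ∑ u ∈ trip n, ∑ v ∈ trip u.1, H v.1 v.2.1 v.2.2 u.2.1 u.2.2
      = ∑ u ∈ trip n, ∑ v ∈ trip u.2.2, H u.1 u.2.1 v.1 v.2.1 v.2.2 := by
  rw [sum_sigma', sum_sigma']
  refine sum_nbij'
    (fun x => ⟨(x.2.1, x.2.2.1, x.2.2.2 + x.1.2.1 + x.1.2.2), (x.2.2.2, x.1.2.1, x.1.2.2)⟩)
    (fun x => ⟨(x.1.1 + x.1.2.1 + x.2.1, x.2.2.1, x.2.2.2), (x.1.1, x.1.2.1, x.2.1)⟩)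
    ?_ ?_ ?_ ?_ ?_ <;>
  · rintro ⟨_, _⟩
    simp only [mem_sigma, mem_trip]
    rintro ⟨h1, h2⟩
    grind

theorem reC2 (H : ℕ → ℕ → ℕ → ℕ → ℕ → M) (n : ℕ) :
    ∑ u ∈ trip n, ∑ v ∈ trip u.2.1, H v.1 v.2.1 u.1 v.2.2 u.2.2
      = ∑ u ∈ trip n, ∑ v ∈ trip u.2.2, H u.1 u.2.1 v.1 v.2.1 v.2.2 := by
  rw [sum_sigma', sum_sigma']
  refine sum_nbij'
    (fun x => ⟨(x.2.1, x.2.2.1, x.1.1 + x.2.2.2 + x.1.2.2), (x.1.1, x.2.2.2, x.1.2.2)⟩)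
    (fun x => ⟨(x.2.1, x.1.1 + x.1.2.1 + x.2.2.1, x.2.2.2), (x.1.1, x.1.2.1, x.2.2.1)⟩)
    ?_ ?_ ?_ ?_ ?_ <;>
  · rintro ⟨_, _⟩
    simp only [mem_sigma, mem_trip]
    rintro ⟨h1, h2⟩
    grind

theorem reC3 (H : ℕ → ℕ → ℕ → ℕ → ℕ → M) (n : ℕ) :
    ∑ u ∈ trip n, ∑ v ∈ trip u.2.2, H v.1 v.2.1 u.1 u.2.1 v.2.2
      = ∑ u ∈ trip n, ∑ v ∈ trip u.2.2, H u.1 u.2.1 v.1 v.2.1 v.2.2 := by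
  rw [sum_sigma', sum_sigma']
  refine sum_nbij'
    (fun x => ⟨(x.2.1, x.2.2.1, x.1.1 + x.1.2.1 + x.2.2.2), (x.1.1, x.1.2.1, x.2.2.2)⟩)
    (fun x => ⟨(x.2.1, x.2.2.1, x.1.1 + x.1.2.1 + x.2.2.2), (x.1.1, x.1.2.1, x.2.2.2)⟩)
    ?_ ?_ ?_ ?_ ?_ <;>
  · rintro ⟨_, _⟩
    simp only [mem_sigma, mem_trip]
    rintro ⟨h1, h2⟩
    grind

theorem trip_swap (G : ℕ → ℕ → ℕ → M) (n : ℕ) :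
    ∑ u ∈ trip n, G u.1 u.2.1 u.2.2 = ∑ u ∈ trip n, G u.2.1 u.1 u.2.2 := by
  refine sum_nbij' (fun x => (x.2.1, x.1, x.2.2)) (fun x => (x.2.1, x.1, x.2.2))
    ?_ ?_ ?_ ?_ ?_ <;>
  · intro x
    simp only [mem_trip]
    grind

theorem trip_rot (G : ℕ → ℕ → ℕ → M) (n : ℕ) :
    ∑ u ∈ trip n, G u.1 u.2.1 u.2.2 = ∑ u ∈ trip n, G u.2.1 u.2.2 u.1 := by
  refine sum_nbij' (fun x => (x.2.2, x.1, x.2.1)) (fun x => (x.2.1, x.2.2, x.1))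
    ?_ ?_ ?_ ?_ ?_ <;>
  · intro x
    simp only [mem_trip]
    grind

theorem trip_top1 (G : ℕ → ℕ → ℕ → M) (n : ℕ) :
    ∑ u ∈ trip n, (if u.1 = n then G u.1 u.2.1 u.2.2 else 0) = G n 0 0 := by
  rw [sum_eq_single (n, 0, 0)]
  · simp
  · rintro ⟨a, b, c⟩ h1 h2
    rw [mem_trip] at h1
    grind
  · intro h; simp [mem_trip] at h

theorem trip_top2 (G : ℕ → ℕ → ℕ → M) (n : ℕ) :
    ∑ u ∈ trip n, (if u.2.1 = n then G u.1 u.2.1 u.2.2 else 0) = G 0 n 0 := by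
  rw [sum_eq_single (0, n, 0)]
  · simp
  · rintro ⟨a, b, c⟩ h1 h2
    rw [mem_trip] at h1
    grind
  · intro h; simp [mem_trip] at h

theorem trip_top3 (G : ℕ → ℕ → ℕ → M) (n : ℕ) :
    ∑ u ∈ trip n, (if u.2.2 = n then G u.1 u.2.1 u.2.2 else 0) = G 0 0 n := by
  rw [sum_eq_single (0, 0, n)]
  · simp
  · rintro ⟨a, b, c⟩ h1 h2
    rw [mem_trip] at h1
    grind
  · intro h; simp [mem_trip] at h

theorem anti_top1 (G : ℕ → ℕ → M) (n : ℕ) :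
    ∑ u ∈ Finset.HasAntidiagonal.antidiagonal n, (if u.1 = n then G u.1 u.2 else 0) = G n 0 := by
  rw [sum_eq_single (n, 0)]
  · simp
  · rintro ⟨a, b⟩ h1 h2
    rw [Finset.HasAntidiagonal.mem_antidiagonal] at h1
    grind
  · intro h; simp at h

theorem anti_top2 (G : ℕ → ℕ → M) (n : ℕ) :
    ∑ u ∈ Finset.HasAntidiagonal.antidiagonal n, (if u.2 = n then G u.1 u.2 else 0) = G 0 n := by
  rw [sum_eq_single (0, n)]
  · simp
  · rintro ⟨a, b⟩ h1 h2
    rw [Finset.HasAntidiagonal.mem_antidiagonal] at h1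
    grind
  · intro h; simp at h

abbrev Tri (k M : Type) [Field k] [AddCommGroup M] [Module k M] :=
  M →ₗ[k] M →ₗ[k] M →ₗ[k] M

/-- The degree `n` coefficient of `φ f - br (φ, φ, φ)`. -/
def obs (S : DJLSTS k M δ) (F : ℕ → Tri k M) (φ : ℕ → (M →ₗ[k] M)) (n : ℕ) : Tri k M :=
  ∑ u ∈ Finset.HasAntidiagonal.antidiagonal n, (F u.2).compr₂ (LinearMap.llcomp k M M M (φ u.1))
    - ∑ u ∈ trip n, (S.br.compl₁₂ (φ u.1) (φ u.2.1)).compr₂ (LinearMap.lcomp k M (φ u.2.2))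

theorem obs_apply (S : DJLSTS k M δ) (F : ℕ → Tri k M) (φ : ℕ → (M →ₗ[k] M)) (n : ℕ)
    (x y z : M) :
    obs S F φ n x y z = ∑ u ∈ Finset.HasAntidiagonal.antidiagonal n, φ u.1 (F u.2 x y z)
      - ∑ u ∈ trip n, S.br (φ u.1 x) (φ u.2.1 y) (φ u.2.2 z) := by
  simp [obs, LinearMap.sum_apply]

/-- `φ` is even, starts with the identity, and intertwines up to degree `< n`. -/
structure Good (S : DJLSTS k M δ) (F : ℕ → Tri k M) (n : ℕ) (φ : ℕ → (M →ₗ[k] M)) : Prop where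
  even : ∀ (p : ℕ) (i : ZMod 2) (x : M), x ∈ S.grade i → φ p x ∈ S.grade i
  zero : φ 0 = LinearMap.id
  eq : ∀ m < n, obs S F φ m = 0

theorem Good.E {S : DJLSTS k M δ} {F : ℕ → Tri k M} {n : ℕ} {φ : ℕ → (M →ₗ[k] M)}
    (h : Good S F n φ) {m : ℕ} (hm : m ≤ n) (x y z : M) :
    ∑ u ∈ Finset.HasAntidiagonal.antidiagonal m, φ u.1 (F u.2 x y z)
      = ∑ u ∈ trip m, S.br (φ u.1 x) (φ u.2.1 y) (φ u.2.2 z)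
        + if m = n then obs S F φ n x y z else 0 := by
  have h1 := obs_apply S F φ m x y z
  split_ifs with hmn
  · subst hmn; rw [h1]; abel
  · rw [h.eq m (lt_of_le_of_ne hm hmn)] at h1
    simp only [LinearMap.zero_apply] at h1
    rw [add_zero]; exact (sub_eq_zero.mp h1.symm)

theorem nest3 {S : DJLSTS k M δ} {F : ℕ → Tri k M} {n : ℕ} {φ : ℕ → (M →ₗ[k] M)}
    (h : Good S F n φ) (hF : F 0 = S.br) (a b c d e : M) :
    ∑ u ∈ Finset.HasAntidiagonal.antidiagonal n, ∑ v ∈ Finset.HasAntidiagonal.antidiagonal u.2, φ u.1 (F v.1 a b (F v.2 c d e))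
      = ∑ u ∈ trip n, ∑ v ∈ trip u.2.2,
          S.br (φ u.1 a) (φ u.2.1 b) (S.br (φ v.1 c) (φ v.2.1 d) (φ v.2.2 e))
        + S.br a b (obs S F φ n c d e) + obs S F φ n a b (S.br c d e) := by
  rw [reA (fun s p r => φ s (F p a b (F r c d e)))]
  have h1 : ∀ u ∈ Finset.HasAntidiagonal.antidiagonal n, ∑ v ∈ Finset.HasAntidiagonal.antidiagonal u.2, φ v.1 (F v.2 a b (F u.1 c d e))
      = ∑ v ∈ trip u.2, S.br (φ v.1 a) (φ v.2.1 b) (φ v.2.2 (F u.1 c d e))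
        + if u.2 = n then obs S F φ n a b (F u.1 c d e) else 0 := by
    intro u hu
    exact h.E (by rw [Finset.HasAntidiagonal.mem_antidiagonal] at hu; omega) _ _ _
  rw [sum_congr rfl h1, sum_add_distrib,
    anti_top2 (fun r _ => obs S F φ n a b (F r c d e)), hF,
    reB3 (fun i j l r => S.br (φ i a) (φ j b) (φ l (F r c d e)))]
  congr 1
  have h2 : ∀ u ∈ trip n, ∑ v ∈ Finset.HasAntidiagonal.antidiagonal u.2.2,
        S.br (φ u.1 a) (φ u.2.1 b) (φ v.1 (F v.2 c d e))
      = ∑ v ∈ trip u.2.2, S.br (φ u.1 a) (φ u.2.1 b) (S.br (φ v.1 c) (φ v.2.1 d) (φ v.2.2 e))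
        + if u.2.2 = n then S.br (φ u.1 a) (φ u.2.1 b) (obs S F φ n c d e) else 0 := by
    intro u hu
    rw [← map_sum, h.E (by rw [mem_trip] at hu; omega), map_add, map_sum]
    split_ifs <;> simp
  rw [sum_congr rfl h2, sum_add_distrib,
    trip_top3 (fun i j _ => S.br (φ i a) (φ j b) (obs S F φ n c d e)), h.zero]
  rfl

theorem nest2 {S : DJLSTS k M δ} {F : ℕ → Tri k M} {n : ℕ} {φ : ℕ → (M →ₗ[k] M)}
    (h : Good S F n φ) (hF : F 0 = S.br) (a b c d e : M) :
    ∑ u ∈ Finset.HasAntidiagonal.antidiagonal n, ∑ v ∈ Finset.HasAntidiagonal.antidiagonal u.2, φ u.1 (F v.1 c (F v.2 a b d) e)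
      = ∑ u ∈ trip n, ∑ v ∈ trip u.2.2,
          S.br (φ v.1 c) (S.br (φ u.1 a) (φ u.2.1 b) (φ v.2.1 d)) (φ v.2.2 e)
        + S.br c (obs S F φ n a b d) e + obs S F φ n c (S.br a b d) e := by
  rw [reA (fun s p r => φ s (F p c (F r a b d) e))]
  have h1 : ∀ u ∈ Finset.HasAntidiagonal.antidiagonal n, ∑ v ∈ Finset.HasAntidiagonal.antidiagonal u.2, φ v.1 (F v.2 c (F u.1 a b d) e)
      = ∑ v ∈ trip u.2, S.br (φ v.1 c) (φ v.2.1 (F u.1 a b d)) (φ v.2.2 e)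
        + if u.2 = n then obs S F φ n c (F u.1 a b d) e else 0 := by
    intro u hu
    exact h.E (by rw [Finset.HasAntidiagonal.mem_antidiagonal] at hu; omega) _ _ _
  rw [sum_congr rfl h1, sum_add_distrib,
    anti_top2 (fun r _ => obs S F φ n c (F r a b d) e), hF,
    reB2 (fun i j l r => S.br (φ i c) (φ j (F r a b d)) (φ l e))]
  congr 1
  have h2 : ∀ u ∈ trip n, ∑ v ∈ Finset.HasAntidiagonal.antidiagonal u.2.1,
        S.br (φ u.1 c) (φ v.1 (F v.2 a b d)) (φ u.2.2 e)
      = ∑ v ∈ trip u.2.1, S.br (φ u.1 c) (S.br (φ v.1 a) (φ v.2.1 b) (φ v.2.2 d)) (φ u.2.2 e)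
        + if u.2.1 = n then S.br (φ u.1 c) (obs S F φ n a b d) (φ u.2.2 e) else 0 := by
    intro u hu
    rw [← LinearMap.sum_apply, ← map_sum, h.E (by rw [mem_trip] at hu; omega), map_add, map_sum,
      LinearMap.add_apply, LinearMap.sum_apply]
    split_ifs <;> simp
  rw [sum_congr rfl h2, sum_add_distrib,
    trip_top2 (fun i _ l => S.br (φ i c) (obs S F φ n a b d) (φ l e)), h.zero,
    reC2 (fun i j l s r => S.br (φ l c) (S.br (φ i a) (φ j b) (φ s d)) (φ r e))]
  rfl

theorem nest1 {S : DJLSTS k M δ} {F : ℕ → Tri k M} {n : ℕ} {φ : ℕ → (M →ₗ[k] M)}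
    (h : Good S F n φ) (hF : F 0 = S.br) (a b c d e : M) :
    ∑ u ∈ Finset.HasAntidiagonal.antidiagonal n, ∑ v ∈ Finset.HasAntidiagonal.antidiagonal u.2, φ u.1 (F v.1 (F v.2 a b c) d e)
      = ∑ u ∈ trip n, ∑ v ∈ trip u.2.2,
          S.br (S.br (φ u.1 a) (φ u.2.1 b) (φ v.1 c)) (φ v.2.1 d) (φ v.2.2 e)
        + S.br (obs S F φ n a b c) d e + obs S F φ n (S.br a b c) d e := by
  rw [reA (fun s p r => φ s (F p (F r a b c) d e))]
  have h1 : ∀ u ∈ Finset.HasAntidiagonal.antidiagonal n, ∑ v ∈ Finset.HasAntidiagonal.antidiagonal u.2, φ v.1 (F v.2 (F u.1 a b c) d e)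
      = ∑ v ∈ trip u.2, S.br (φ v.1 (F u.1 a b c)) (φ v.2.1 d) (φ v.2.2 e)
        + if u.2 = n then obs S F φ n (F u.1 a b c) d e else 0 := by
    intro u hu
    exact h.E (by rw [Finset.HasAntidiagonal.mem_antidiagonal] at hu; omega) _ _ _
  rw [sum_congr rfl h1, sum_add_distrib,
    anti_top2 (fun r _ => obs S F φ n (F r a b c) d e), hF,
    reB1 (fun i j l r => S.br (φ i (F r a b c)) (φ j d) (φ l e))]
  congr 1
  have h2 : ∀ u ∈ trip n, ∑ v ∈ Finset.HasAntidiagonal.antidiagonal u.1,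
        S.br (φ v.1 (F v.2 a b c)) (φ u.2.1 d) (φ u.2.2 e)
      = ∑ v ∈ trip u.1, S.br (S.br (φ v.1 a) (φ v.2.1 b) (φ v.2.2 c)) (φ u.2.1 d) (φ u.2.2 e)
        + if u.1 = n then S.br (obs S F φ n a b c) (φ u.2.1 d) (φ u.2.2 e) else 0 := by
    intro u hu
    rw [← LinearMap.sum_apply, ← LinearMap.sum_apply, ← map_sum,
      h.E (by rw [mem_trip] at hu; omega), map_add, map_sum,
      LinearMap.add_apply, LinearMap.sum_apply, LinearMap.add_apply, LinearMap.sum_apply]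
    split_ifs <;> simp
  rw [sum_congr rfl h2, sum_add_distrib,
    trip_top1 (fun _ j l => S.br (obs S F φ n a b c) (φ j d) (φ l e)), h.zero,
    reC1 (fun i j l s r => S.br (S.br (φ i a) (φ j b) (φ l c)) (φ s d) (φ r e))]
  rfl

theorem obs_cocycle {S : DJLSTS k M δ} {F : ℕ → Tri k M} {n : ℕ} {φ : ℕ → (M →ₗ[k] M)}
    (h : Good S F n φ) (hd : IsDeformation S F) : IsCocycle3 S (obs S F φ n) := by
  obtain ⟨hF, -, -, -, hfund⟩ := hd
  intro i j l m a b c d ha hb hc hd e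
  have key : ∑ u ∈ Finset.HasAntidiagonal.antidiagonal n, ∑ v ∈ Finset.HasAntidiagonal.antidiagonal u.2, φ u.1 (F v.1 a b (F v.2 c d e))
      = ∑ u ∈ Finset.HasAntidiagonal.antidiagonal n, ∑ v ∈ Finset.HasAntidiagonal.antidiagonal u.2, φ u.1 (F v.1 (F v.2 a b c) d e)
        + sgn k l (i + j) •
          ∑ u ∈ Finset.HasAntidiagonal.antidiagonal n, ∑ v ∈ Finset.HasAntidiagonal.antidiagonal u.2, φ u.1 (F v.1 c (F v.2 a b d) e)
        + (δ * sgn k (i + j) (l + m)) •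
          ∑ u ∈ Finset.HasAntidiagonal.antidiagonal n, ∑ v ∈ Finset.HasAntidiagonal.antidiagonal u.2, φ u.1 (F v.1 c d (F v.2 a b e)) := by
    simp only [smul_sum, ← sum_add_distrib, ← map_smul, ← map_add]
    refine sum_congr rfl fun u _ => ?_
    rw [← map_sum, ← map_sum]
    congr 1
    have := hfund u.2 ha hb hc hd e
    rw [Finset.Nat.sum_antidiagonal_eq_sum_range_succ (fun p r => F p a b (F r c d e)),
      Finset.Nat.sum_antidiagonal_eq_sum_range_succ_mk]
    simpa using this
  have key2 : ∑ u ∈ trip n, ∑ v ∈ trip u.2.2,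
          S.br (φ u.1 a) (φ u.2.1 b) (S.br (φ v.1 c) (φ v.2.1 d) (φ v.2.2 e))
      = ∑ u ∈ trip n, ∑ v ∈ trip u.2.2,
          S.br (S.br (φ u.1 a) (φ u.2.1 b) (φ v.1 c)) (φ v.2.1 d) (φ v.2.2 e)
        + sgn k l (i + j) • ∑ u ∈ trip n, ∑ v ∈ trip u.2.2,
          S.br (φ v.1 c) (S.br (φ u.1 a) (φ u.2.1 b) (φ v.2.1 d)) (φ v.2.2 e)
        + (δ * sgn k (i + j) (l + m)) • ∑ u ∈ trip n, ∑ v ∈ trip u.2.2,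
          S.br (φ v.1 c) (φ v.2.1 d) (S.br (φ u.1 a) (φ u.2.1 b) (φ v.2.2 e)) := by
    simp only [smul_sum, ← sum_add_distrib]
    refine sum_congr rfl fun u _ => sum_congr rfl fun v _ => ?_
    exact S.fund (h.even _ _ _ ha) (h.even _ _ _ hb) (h.even _ _ _ hc) (h.even _ _ _ hd) _
  rw [nest3 h hF, nest2 h hF, nest1 h hF, nest3 h hF,
    reC3 (fun i j l s r => S.br (φ l c) (φ s d) (S.br (φ i a) (φ j b) (φ r e))), key2] at key
  simp only [smul_add] at key ⊢
  rw [← sub_eq_zero] at key ⊢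
  rw [← key]
  abel

theorem obs_skew {S : DJLSTS k M δ} {F : ℕ → Tri k M} {n : ℕ} {φ : ℕ → (M →ₗ[k] M)}
    (h : Good S F n φ) (hd : IsDeformation S F) {i j : ZMod 2} {a b : M}
    (ha : a ∈ S.grade i) (hb : b ∈ S.grade j) (c : M) :
    obs S F φ n b a c = -((δ * sgn k i j) • obs S F φ n a b c) := by
  obtain ⟨hF, -, hs, -, -⟩ := hd
  rw [obs_apply, obs_apply, trip_swap (fun p q r => S.br (φ p b) (φ q a) (φ r c)),
    smul_sub, smul_sum, smul_sum, neg_sub', ← sum_neg_distrib, ← sum_neg_distrib]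
  congr 1
  · refine sum_congr rfl fun u _ => ?_
    rw [hs _ ha hb, map_neg, map_smul]
  · refine sum_congr rfl fun u _ => ?_
    exact S.skew (h.even _ _ _ ha) (h.even _ _ _ hb) _

theorem obs_cyclic {S : DJLSTS k M δ} {F : ℕ → Tri k M} {n : ℕ} {φ : ℕ → (M →ₗ[k] M)}
    (h : Good S F n φ) (hd : IsDeformation S F) {i j l : ZMod 2} {a b c : M}
    (ha : a ∈ S.grade i) (hb : b ∈ S.grade j) (hc : c ∈ S.grade l) :
    sgn k i l • obs S F φ n a b c + sgn k j i • obs S F φ n b c a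
      + sgn k l j • obs S F φ n c a b = 0 := by
  obtain ⟨hF, -, -, hs, -⟩ := hd
  have e1 : sgn k i l • ∑ u ∈ Finset.HasAntidiagonal.antidiagonal n, φ u.1 (F u.2 a b c)
      + sgn k j i • ∑ u ∈ Finset.HasAntidiagonal.antidiagonal n, φ u.1 (F u.2 b c a)
      + sgn k l j • ∑ u ∈ Finset.HasAntidiagonal.antidiagonal n, φ u.1 (F u.2 c a b) = 0 := by
    simp only [smul_sum, ← sum_add_distrib, ← map_smul, ← map_add]
    refine sum_eq_zero fun u _ => ?_
    have := hs u.2 ha hb hc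
    simp only [map_smul]
    rw [this, map_zero]
  have e2 : sgn k i l • ∑ u ∈ trip n, S.br (φ u.1 a) (φ u.2.1 b) (φ u.2.2 c)
      + sgn k j i • ∑ u ∈ trip n, S.br (φ u.1 b) (φ u.2.1 c) (φ u.2.2 a)
      + sgn k l j • ∑ u ∈ trip n, S.br (φ u.1 c) (φ u.2.1 a) (φ u.2.2 b) = 0 := by
    rw [trip_rot (fun p q r => S.br (φ p b) (φ q c) (φ r a)),
      ← trip_rot (fun p q r => S.br (φ r c) (φ p a) (φ q b))]
    simp only [smul_sum, ← sum_add_distrib]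
    refine sum_eq_zero fun u _ => ?_
    exact S.cyclic (h.even _ _ _ ha) (h.even _ _ _ hb) (h.even _ _ _ hc)
  simp only [obs_apply, smul_sub]
  rw [← sub_eq_zero.mpr (e1.trans e2.symm)]
  abel

theorem obs_grade {S : DJLSTS k M δ} {F : ℕ → Tri k M} {n : ℕ} {φ : ℕ → (M →ₗ[k] M)}
    (h : Good S F n φ) (hd : IsDeformation S F) {i j l : ZMod 2} {a b c : M}
    (ha : a ∈ S.grade i) (hb : b ∈ S.grade j) (hc : c ∈ S.grade l) :
    obs S F φ n a b c ∈ S.grade (i + j + l) := by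
  obtain ⟨hF, hg, -, -, -⟩ := hd
  rw [obs_apply]
  refine sub_mem (sum_mem fun u _ => ?_) (sum_mem fun u _ => ?_)
  · exact h.even _ _ _ (hg _ ha hb hc)
  · exact S.grade_br (h.even _ _ _ ha) (h.even _ _ _ hb) (h.even _ _ _ hc)

theorem obs_congr (S : DJLSTS k M δ) (F : ℕ → Tri k M) {φ φ' : ℕ → (M →ₗ[k] M)} {m : ℕ}
    (h : ∀ p ≤ m, φ' p = φ p) : obs S F φ' m = obs S F φ m := by
  unfold obs
  congr 1
  · refine sum_congr rfl fun u hu => ?_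
    rw [Finset.HasAntidiagonal.mem_antidiagonal] at hu
    rw [h u.1 (by omega)]
  · refine sum_congr rfl fun u hu => ?_
    rw [mem_trip] at hu
    rw [h u.1 (by omega), h u.2.1 (by omega), h u.2.2 (by omega)]

theorem obs_add {S : DJLSTS k M δ} {F : ℕ → Tri k M} {n : ℕ} {φ : ℕ → (M →ₗ[k] M)}
    (hn : n ≠ 0) (h0 : φ 0 = LinearMap.id) (hF : F 0 = S.br) (g : M →ₗ[k] M) (x y z : M) :
    obs S F (fun p => φ p + if p = n then g else 0) n x y z
      = obs S F φ n x y z + g (S.br x y z)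
        - S.br (g x) y z - S.br x (g y) z - S.br x y (g z) := by
  have e1 : ∑ u ∈ Finset.HasAntidiagonal.antidiagonal n, (φ u.1 + if u.1 = n then g else 0) (F u.2 x y z)
      = ∑ u ∈ Finset.HasAntidiagonal.antidiagonal n, φ u.1 (F u.2 x y z) + g (S.br x y z) := by
    rw [← hF, ← anti_top1 (fun _ q => g (F q x y z)) n, ← sum_add_distrib]
    refine sum_congr rfl fun u _ => ?_
    split_ifs <;> simp
  have e2 : ∑ u ∈ trip n, S.br ((φ u.1 + if u.1 = n then g else 0) x)
        ((φ u.2.1 + if u.2.1 = n then g else 0) y) ((φ u.2.2 + if u.2.2 = n then g else 0) z)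
      = ∑ u ∈ trip n, S.br (φ u.1 x) (φ u.2.1 y) (φ u.2.2 z)
        + S.br (g x) y z + S.br x (g y) z + S.br x y (g z) := by
    have t1 := trip_top1 (fun _ q r => S.br (g x) (φ q y) (φ r z)) n
    have t2 := trip_top2 (fun p _ r => S.br (φ p x) (g y) (φ r z)) n
    have t3 := trip_top3 (fun p q _ => S.br (φ p x) (φ q y) (g z)) n
    simp only [h0, LinearMap.id_apply] at t1 t2 t3
    rw [← t1, ← t2, ← t3, ← sum_add_distrib, ← sum_add_distrib, ← sum_add_distrib]
    refine sum_congr rfl fun u hu => ?_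
    rw [mem_trip] at hu
    split_ifs <;> first | (exfalso; omega) | simp
  rw [obs_apply, obs_apply, e1, e2]
  abel

end Rigidity

/-- if `H³_δ(T,T) = 0` (every even 3-cocycle is the coboundary `d¹g` of an
even 1-cochain `g`), then `T` is analytically rigid: every formal deformation is
equivalent to the null deformation. -/
theorem stmt15 (S : DJLSTS k M δ)
    (hH : ∀ ψ : M →ₗ[k] M →ₗ[k] M →ₗ[k] M,
      (∀ {i j l : ZMod 2} {a b c : M},
          a ∈ S.grade i → b ∈ S.grade j → c ∈ S.grade l → ψ a b c ∈ S.grade (i + j + l)) →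
      (∀ {i j : ZMod 2} {a b : M}, a ∈ S.grade i → b ∈ S.grade j → ∀ c : M,
          ψ b a c = -((δ * sgn k i j) • ψ a b c)) →
      (∀ {i j l : ZMod 2} {a b c : M},
          a ∈ S.grade i → b ∈ S.grade j → c ∈ S.grade l →
          sgn k i l • ψ a b c + sgn k j i • ψ b c a + sgn k l j • ψ c a b = 0) →
      IsCocycle3 S ψ →
      ∃ g : M →ₗ[k] M, (∀ (i : ZMod 2) (x : M), x ∈ S.grade i → g x ∈ S.grade i) ∧
        ∀ x₁ x₂ x₃ : M,
          ψ x₁ x₂ x₃ = S.br (g x₁) x₂ x₃ + S.br x₁ (g x₂) x₃ + S.br x₁ x₂ (g x₃)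
            - g (S.br x₁ x₂ x₃)) :
    ∀ F : ℕ → (M →ₗ[k] M →ₗ[k] M →ₗ[k] M), IsDeformation S F →
      ∃ φ : ℕ → (M →ₗ[k] M),
        DefEquiv S F (fun n => if n = 0 then S.br else 0) φ := by
  intro F hF
  have h0 := hF.1
  have base : Good S F 1 (fun p => if p = 0 then LinearMap.id else 0) := by
    refine ⟨?_, by simp, ?_⟩
    · intro p i x hx
      by_cases hp : p = 0 <;> simp [hp, hx]
    · intro m hm
      obtain rfl : m = 0 := by omega
      ext x y z
      rw [obs_apply]
      have : trip 0 = {(0, 0, 0)} := by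
        ext ⟨p, q, r⟩
        simp only [mem_trip, Finset.mem_singleton, Prod.mk.injEq]
        omega
      simp [this, h0]
  have step : ∀ n φ, Good S F (n + 1) φ →
      ∃ φ', Good S F (n + 2) φ' ∧ ∀ p < n + 1, φ' p = φ p := by
    intro n φ h
    obtain ⟨g, hg, hgeq⟩ := hH (obs S F φ (n + 1)) (obs_grade h hF) (obs_skew h hF)
      (obs_cyclic h hF) (obs_cocycle h hF)
    have hlow : ∀ p < n + 1, (fun p => φ p + if p = n + 1 then g else 0) p = φ p := by
      intro p hp
      have : p ≠ n + 1 := by omega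
      simp [this]
    refine ⟨fun p => φ p + if p = n + 1 then g else 0, ⟨?_, ?_, ?_⟩, hlow⟩
    · intro p i x hx
      have := h.even p i x hx
      by_cases hp : p = n + 1
      · simpa [hp] using add_mem (h.even (n + 1) i x hx) (hg i x hx)
      · simpa [hp] using this
    · exact (hlow 0 (by omega)).trans h.zero
    · intro m hm
      by_cases hmn : m = n + 1
      · subst hmn
        ext x y z
        rw [obs_add (by omega) h.zero h0, hgeq]
        simp only [LinearMap.zero_apply]
        abel
      · rw [obs_congr S F (fun p hp => hlow p (by omega)), h.eq m (by omega)]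
  choose! nxt hnxt using step
  let Φ : ℕ → ℕ → (M →ₗ[k] M) :=
    fun n => Nat.rec (fun p => if p = 0 then LinearMap.id else 0) (fun n φ => nxt n φ) n
  have hΦ : ∀ n, Good S F (n + 1) (Φ n) := by
    intro n
    induction n with
    | zero => exact base
    | succ n ih => exact (hnxt n _ ih).1
  have hst : ∀ p n, p ≤ n → Φ n p = Φ p p := by
    intro p n hpn
    induction n, hpn using Nat.le_induction with
    | base => rfl
    | succ n hn ih => rw [← ih]; exact (hnxt n _ (hΦ n)).2 p (by omega)
  refine ⟨fun p => Φ p p, (hΦ 0).zero, ?_⟩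
  intro n x y z
  have hz : obs S F (fun p => Φ p p) n = 0 := by
    rw [obs_congr S F (φ := Φ n) (fun p hp => (hst p n hp).symm)]
    exact (hΦ n).eq n (by omega)
  have hz' := obs_apply S F (fun p => Φ p p) n x y z
  rw [hz] at hz'
  have hz2 := sub_eq_zero.mp hz'.symm
  rw [Finset.Nat.sum_antidiagonal_eq_sum_range_succ (fun p r => (Φ p p) (F r x y z))] at hz2
  refine hz2.trans ?_
  rw [← Finset.sum_filter_add_sum_filter_not (Finset.Nat.antidiagonalTuple 4 n) (fun q => q 0 = 0)]
  rw [Finset.sum_eq_zero (s := Finset.filter (fun q => ¬ q 0 = 0) (Finset.Nat.antidiagonalTuple 4 n))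
    (by intro q hq; rw [Finset.mem_filter] at hq; simp [hq.2]), add_zero]
  refine Finset.sum_nbij' (fun u => ![0, u.1, u.2.1, u.2.2]) (fun q => (q 1, q 2, q 3))
    ?_ ?_ ?_ ?_ ?_
  · intro u hu
    rw [mem_trip] at hu
    simp [Finset.Nat.mem_antidiagonalTuple, Fin.sum_univ_four, hu]
  · intro q hq
    rw [Finset.mem_filter, Finset.Nat.mem_antidiagonalTuple, Fin.sum_univ_four] at hq
    rw [mem_trip]
    dsimp only
    omega
  · intro u hu; rfl
  · intro q hq
    rw [Finset.mem_filter] at hq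
    funext i
    fin_cases i <;> simp [hq.2]
  · intro u hu
    simp
end

section
/- Let T be a δ-Jordan Lie supertriple system and N: T → T a Nijenhuis operator. Define ψ(x₁,x₂,x₃) = [Nx₁,x₂,x₃] + [x₁,Nx₂,x₃] + [x₁,x₂,Nx₃] - N[x₁,x₂,x₃]. Then [·,·,·]_λ = [·,·,·] + λψ is a δ-Jordan Lie supertriple system structure for all λ, and this deformation is trivial: φ_λ = id + λN satisfies φ_λ[x₁,x₂,x₃]_λ = [φ_λx₁, φ_λx₂, φ_λx₃]. -/
variable {k : Type} [Field k] {M : Type} [AddCommGroup M] [Module k M] {δ : k}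
variable {W : Type} [AddCommGroup W] [Module k W]

/-- The deformed bracket. -/
def brL (S : DJLSTS k M δ) (N : M →ₗ[k] M) (lam : k) : M →ₗ[k] M →ₗ[k] M →ₗ[k] M :=
  S.br + lam • (S.br ∘ₗ N + S.br.compl₂ N + S.br.compr₂ (LinearMap.lcomp k M N)
    - S.br.compr₂ (LinearMap.llcomp k M M M N))

theorem brL_apply (S : DJLSTS k M δ) (N : M →ₗ[k] M) (lam : k) (x₁ x₂ x₃ : M) :
    brL S N lam x₁ x₂ x₃ = S.br x₁ x₂ x₃
      + lam • (S.br (N x₁) x₂ x₃ + S.br x₁ (N x₂) x₃ + S.br x₁ x₂ (N x₃)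
        - N (S.br x₁ x₂ x₃)) := by
  simp [brL]

set_option maxHeartbeats 4000000 in
theorem brL_fund (S : DJLSTS k M δ) (N : M →ₗ[k] M) (hN : IsNijenhuis S N)
    (hNeven : ∀ (i : ZMod 2) (x : M), x ∈ S.grade i → N x ∈ S.grade i) (lam : k)
    {i j l m : ZMod 2} {a b c d : M} (ha : a ∈ S.grade i) (hb : b ∈ S.grade j)
    (hc : c ∈ S.grade l) (hd : d ∈ S.grade m) (e : M) :
    brL S N lam a b (brL S N lam c d e) = brL S N lam (brL S N lam a b c) d e
      + sgn k l (i + j) • brL S N lam c (brL S N lam a b d) e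
      + (δ * sgn k (i + j) (l + m)) • brL S N lam c d (brL S N lam a b e) := by
  have g := S.fund ha hb hc hd e
  have g0 := S.fund (hNeven _ _ ha) hb hc hd e
  have g1 := S.fund ha (hNeven _ _ hb) hc hd e
  have g2 := S.fund ha hb (hNeven _ _ hc) hd e
  have g3 := S.fund ha hb hc (hNeven _ _ hd) e
  have g4 := S.fund ha hb hc hd (N e)
  have g01 := S.fund (hNeven _ _ ha) (hNeven _ _ hb) hc hd e
  have g02 := S.fund (hNeven _ _ ha) hb (hNeven _ _ hc) hd e
  have g03 := S.fund (hNeven _ _ ha) hb hc (hNeven _ _ hd) e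
  have g04 := S.fund (hNeven _ _ ha) hb hc hd (N e)
  have g12 := S.fund ha (hNeven _ _ hb) (hNeven _ _ hc) hd e
  have g13 := S.fund ha (hNeven _ _ hb) hc (hNeven _ _ hd) e
  have g14 := S.fund ha (hNeven _ _ hb) hc hd (N e)
  have g23 := S.fund ha hb (hNeven _ _ hc) (hNeven _ _ hd) e
  have g24 := S.fund ha hb (hNeven _ _ hc) hd (N e)
  have g34 := S.fund ha hb hc (hNeven _ _ hd) (N e)
  have Ng := congrArg N g
  have Ng0 := congrArg N g0
  have Ng1 := congrArg N g1
  have Ng2 := congrArg N g2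
  have Ng3 := congrArg N g3
  have Ng4 := congrArg N g4
  have NNg := congrArg N Ng
  have n1 := congrArg (S.br a b) (hN.2 c d e)
  have n2 := congrArg (fun x => S.br x d e) (hN.2 a b c)
  have n3 := congrArg (fun x => S.br c x e) (hN.2 a b d)
  have n4 := congrArg (S.br c d) (hN.2 a b e)
  have m1 := hN.2 a b (S.br c d e)
  have m2 := hN.2 (S.br a b c) d e
  have m3 := hN.2 c (S.br a b d) e
  have m4 := hN.2 c d (S.br a b e)
  simp only [map_add, map_sub, map_smul, LinearMap.add_apply, LinearMap.sub_apply,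
    LinearMap.smul_apply] at Ng NNg Ng0 Ng1 Ng2 Ng3 Ng4 n1 n2 n3 n4
  simp only [brL_apply, map_add, map_sub, map_smul, LinearMap.add_apply, LinearMap.sub_apply,
    LinearMap.smul_apply]
  generalize sgn k l (i + j) = s1 at *
  generalize δ * sgn k (i + j) (l + m) = s2 at *
  linear_combination (norm := module) g + lam • g0 + lam • g1 + lam • g2 + lam • g3 + lam • g4 - lam • Ng
       + lam ^ 2 • g01 + lam ^ 2 • g02 + lam ^ 2 • g03 + lam ^ 2 • g04 + lam ^ 2 • g12 + lam ^ 2 • g13 + lam ^ 2 • g14 + lam ^ 2 • g23 + lam ^ 2 • g24 + lam ^ 2 • g34 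
       - lam ^ 2 • Ng0 - lam ^ 2 • Ng1 - lam ^ 2 • Ng2 - lam ^ 2 • Ng3 - lam ^ 2 • Ng4 + lam ^ 2 • NNg
      + lam ^ 2 • (-n1 - m1) + lam ^ 2 • (n2 + m2) + (lam ^ 2 * s1) • (n3 + m3)
      + (lam ^ 2 * s2) • (n4 + m4)

/-- a Nijenhuis operator `N` yields, via `ψ = d¹N`, a deformation
`[·,·,·]_λ = [·,·,·] + λψ` of `T`, and this deformation is trivial:
`φ_λ = id + λN` intertwines `[·,·,·]_λ` with `[·,·,·]`. -/
theorem stmt17 (S : DJLSTS k M δ) (N : M →ₗ[k] M) (hN : IsNijenhuis S N)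
    (hNeven : ∀ (i : ZMod 2) (x : M), x ∈ S.grade i → N x ∈ S.grade i) :
    (∀ lam : k, ∃ Sl : DJLSTS k M δ, Sl.grade = S.grade ∧
      ∀ x₁ x₂ x₃ : M,
        Sl.br x₁ x₂ x₃
          = S.br x₁ x₂ x₃
            + lam • (S.br (N x₁) x₂ x₃ + S.br x₁ (N x₂) x₃ + S.br x₁ x₂ (N x₃)
                - N (S.br x₁ x₂ x₃))) ∧
    (∀ (lam : k) (x₁ x₂ x₃ : M),
      (S.br x₁ x₂ x₃
          + lam • (S.br (N x₁) x₂ x₃ + S.br x₁ (N x₂) x₃ + S.br x₁ x₂ (N x₃)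
              - N (S.br x₁ x₂ x₃)))
        + lam • N (S.br x₁ x₂ x₃
            + lam • (S.br (N x₁) x₂ x₃ + S.br x₁ (N x₂) x₃ + S.br x₁ x₂ (N x₃)
                - N (S.br x₁ x₂ x₃)))
        = S.br (x₁ + lam • N x₁) (x₂ + lam • N x₂) (x₃ + lam • N x₃)) := by
  have h1 := hN.1
  have h2 := hN.2
  refine ⟨fun lam => ⟨⟨S.grade, S.direct, brL S N lam, S.delta_pm, ?_, ?_, ?_, ?_⟩, rfl,
    brL_apply S N lam⟩, ?_⟩
  · intro i j l a b c ha hb hc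
    rw [brL_apply]
    have h := S.grade_br ha hb hc
    exact add_mem h (Submodule.smul_mem _ _ (sub_mem (add_mem (add_mem
      (S.grade_br (hNeven _ _ ha) hb hc) (S.grade_br ha (hNeven _ _ hb) hc))
      (S.grade_br ha hb (hNeven _ _ hc))) (hNeven _ _ h)))
  · intro i j a b ha hb c
    simp only [brL_apply]
    rw [S.skew ha hb c, S.skew ha (hNeven _ _ hb) c, S.skew (hNeven _ _ ha) hb c,
      S.skew ha hb (N c)]
    simp only [map_neg, map_smul]
    module
  · intro i j l a b c ha hb hc
    have g := S.cyclic ha hb hc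
    have g0 := S.cyclic (hNeven _ _ ha) hb hc
    have g1 := S.cyclic ha (hNeven _ _ hb) hc
    have g2 := S.cyclic ha hb (hNeven _ _ hc)
    have Ng := congrArg N g
    simp only [map_add, map_smul, map_zero] at Ng
    simp only [brL_apply]
    linear_combination (norm := module) g + lam • g0 + lam • g1 + lam • g2 - lam • Ng
  · intro i j l m a b c d ha hb hc hd e
    exact brL_fund S N hN hNeven lam ha hb hc hd e
  · intro lam x y z
    have e1 := h1 x y z
    have e2 := h2 x y z
    simp only [map_add, map_sub, map_smul, LinearMap.add_apply, LinearMap.smul_apply]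
    linear_combination (norm := module) (-lam ^ 2) • e2 - lam ^ 3 • e1
end
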